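/- Let S be a maximal triangular subalgebra of B(H) possessing a projection p ∈ lat(S) with p ≠ 0 and p ≠ 1, and suppose lat(S) is strongly continuous at 1, i.e., the union of the ranges of the projections in lat(S) \ {1} has dense linear span in H (equivalently, 1 is the strong limit of projections in lat(S) \ {1}). Then every bounded derivation δ : S → B(H) is implemented: there exists b ∈ B(H) with ‖b‖ ≤ 2‖δ‖ such that δ(a) = b a − a b for all a ∈ S. -/

import Mathlib

set_option maxHeartbeats 1000000
set_option synthInstance.maxHeartbeats 400000

open ContinuousLinearMap in
/-- The diagonal `S ∩ S*` of a subalgebra of `B(H)`. -/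
def diagonal {H : Type*} [NormedAddCommGroup H] [InnerProductSpace ℂ H] [CompleteSpace H]
    (S : Subalgebra ℂ (H →L[ℂ] H)) : Set (H →L[ℂ] H) :=
  {a | a ∈ S ∧ adjoint a ∈ S}

/-- A set of operators is maximal abelian in `B(H)` if it is commutative and contains
every operator commuting with all of its members. -/
def IsMaxAbelian {H : Type*} [NormedAddCommGroup H] [InnerProductSpace ℂ H]
    (D : Set (H →L[ℂ] H)) : Prop :=
  (∀ a ∈ D, ∀ b ∈ D, a * b = b * a) ∧
  (∀ b : H →L[ℂ] H, (∀ a ∈ D, a * b = b * a) → b ∈ D)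

/-- A (unital) subalgebra of `B(H)` is triangular if its diagonal `S ∩ S*` is
maximal abelian in `B(H)`. -/
def IsTriangular {H : Type*} [NormedAddCommGroup H] [InnerProductSpace ℂ H] [CompleteSpace H]
    (S : Subalgebra ℂ (H →L[ℂ] H)) : Prop :=
  IsMaxAbelian (diagonal S)

/-- `S` is maximal triangular if it is triangular and not properly contained in any
other triangular subalgebra. -/
def IsMaxTriangular {H : Type*} [NormedAddCommGroup H] [InnerProductSpace ℂ H] [CompleteSpace H]
    (S : Subalgebra ℂ (H →L[ℂ] H)) : Prop :=
  IsTriangular S ∧ ∀ T : Subalgebra ℂ (H →L[ℂ] H), IsTriangular T → S ≤ T → S = T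

open ContinuousLinearMap in
/-- `p ∈ lat S`: `p` is an orthogonal projection with `a p = p a p` for all `a ∈ S`. -/
def InLat {H : Type*} [NormedAddCommGroup H] [InnerProductSpace ℂ H] [CompleteSpace H]
    (S : Subalgebra ℂ (H →L[ℂ] H)) (p : H →L[ℂ] H) : Prop :=
  p * p = p ∧ adjoint p = p ∧ ∀ a ∈ S, a * p = p * a * p

/-- A bounded derivation from `S` into `B(H)`: a continuous linear map obeying the
Leibniz product rule on `S`. -/
def IsDerivation {H : Type*} [NormedAddCommGroup H] [InnerProductSpace ℂ H] [CompleteSpace H]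
    (S : Subalgebra ℂ (H →L[ℂ] H)) (δ : S →L[ℂ] (H →L[ℂ] H)) : Prop :=
  ∀ a b : S, δ (a * b) = δ a * (b : H →L[ℂ] H) + (a : H →L[ℂ] H) * δ b

open ContinuousLinearMap Filter Topology InnerProductSpace

section

variable {H : Type*} [NormedAddCommGroup H] [InnerProductSpace ℂ H] [CompleteSpace H]
  {S : Subalgebra ℂ (H →L[ℂ] H)}

/-- An invariant projection of a triangular algebra belongs to the diagonal. -/
theorem InLat.mem_diagonal (hS : IsTriangular S) {p : H →L[ℂ] H} (hp : InLat S p) :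
    p ∈ diagonal S := by
  refine hS.2 p fun d hd => ?_
  have h1 := hp.2.2 d hd.1
  have h2 := congrArg adjoint (hp.2.2 _ hd.2)
  simp only [mul_def, adjoint_comp, adjoint_adjoint, hp.2.1] at h2
  rw [h1, mul_assoc]
  exact h2.symm

/-- A maximal triangular algebra contains every corner `p B(H) (1 - p)` with `p ∈ lat S`. -/
theorem InLat.corner_mem (hS : IsMaxTriangular S) {p : H →L[ℂ] H} (hp : InLat S p)
    (x : H →L[ℂ] H) : p * x * (1 - p) ∈ S := by
  have hpS : p ∈ S := (hp.mem_diagonal hS.1).1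
  have hpp : p * p = p := hp.1
  have hqp : (1 - p) * p = 0 := by rw [sub_mul, one_mul, hpp, sub_self]
  have hqap : ∀ a ∈ S, (1 - p) * a * p = 0 := fun a ha => by
    have := hp.2.2 a ha
    rw [sub_mul, sub_mul, one_mul, ← this, sub_self]
  have hqa : ∀ a ∈ S, (1 - p) * a = (1 - p) * a * (1 - p) := fun a ha => by
    rw [mul_sub, hqap a ha, mul_one, sub_zero]
  let T : Subalgebra ℂ (H →L[ℂ] H) :=
    { carrier := {t | ∃ a ∈ S, ∃ y : H →L[ℂ] H, t = a + p * y * (1 - p)}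
      mul_mem' := by
        rintro _ _ ⟨a, ha, y, rfl⟩ ⟨c, hc, z, rfl⟩
        refine ⟨a * c, S.mul_mem ha hc, a * p * z + y * ((1 - p) * c), ?_⟩
        have h1 : a * (p * z * (1 - p)) = p * (a * p * z) * (1 - p) := by
          simp only [← mul_assoc]
          rw [← hp.2.2 a ha]
        have h2 : p * y * (1 - p) * c = p * (y * ((1 - p) * c)) * (1 - p) := by
          rw [mul_assoc (p * y), hqa c hc]
          simp only [mul_assoc]
          rw [show (1 - p) * (1 - p) = 1 - p by rw [mul_sub, hqp, mul_one, sub_zero]]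
        have h3 : p * y * (1 - p) * (p * z * (1 - p)) = 0 := by
          rw [show p * y * (1 - p) * (p * z * (1 - p))
            = p * y * ((1 - p) * p) * (z * (1 - p)) by simp only [mul_assoc], hqp]
          simp
        rw [add_mul, mul_add, mul_add, h1, h2, h3]
        noncomm_ring
      add_mem' := by
        rintro _ _ ⟨a, ha, y, rfl⟩ ⟨c, hc, z, rfl⟩
        exact ⟨a + c, S.add_mem ha hc, y + z, by noncomm_ring⟩
      algebraMap_mem' := fun r => ⟨_, S.algebraMap_mem r, 0, by simp⟩ }
  have hST : S ≤ T := fun a ha => ⟨a, ha, 0, by simp⟩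
  have hlow : ∀ t ∈ T, (1 - p) * t * p = 0 := by
    rintro _ ⟨a, ha, y, rfl⟩
    rw [mul_add, add_mul, hqap a ha, ← mul_assoc, ← mul_assoc, hqp]
    simp
  have hadjq : adjoint (1 - p) = 1 - p := by
    rw [map_sub, hp.2.1, one_def, adjoint_id]
  have hup : ∀ t, adjoint t ∈ T → p * t * (1 - p) = 0 := fun t ht => by
    have := congrArg adjoint (hlow _ ht)
    simp only [mul_def, adjoint_comp, adjoint_adjoint, hp.2.1, hadjq, map_zero] at this
    simpa only [mul_def, comp_assoc] using this
  have hmem : ∀ t ∈ T, adjoint t ∈ T → t ∈ S := by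
    rintro t ht ht'
    have h0 := hup t ht'
    obtain ⟨a, ha, y, rfl⟩ := ht
    have h1 : p * a * (1 - p) + p * y * (1 - p) = 0 := by
      rw [← h0, mul_add, add_mul, ← mul_assoc p, ← mul_assoc p, hpp, mul_assoc (p * y),
        show (1 - p) * (1 - p) = 1 - p by rw [mul_sub, hqp, mul_one, sub_zero]]
    rw [eq_neg_of_add_eq_zero_right h1]
    exact S.add_mem ha (S.neg_mem
      (S.mul_mem (S.mul_mem hpS ha) (S.sub_mem S.one_mem hpS)))
  have hdiag : diagonal T = diagonal S := by
    ext t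
    refine ⟨fun ht => ⟨hmem t ht.1 ht.2, hmem _ ht.2 ?_⟩, fun ht => ⟨hST ht.1, hST ht.2⟩⟩
    rw [adjoint_adjoint]
    exact ht.1
  have hT : S = T := hS.2 T (by rw [IsTriangular, hdiag]; exact hS.1) hST
  rw [hT]
  exact ⟨0, S.zero_mem, x, by simp⟩

/-- The invariant projections of a maximal triangular algebra are totally ordered. -/
theorem InLat.total (hS : IsMaxTriangular S) {p r : H →L[ℂ] H} (hp : InLat S p)
    (hr : InLat S r) : r * p = p ∨ p * r = r := by
  by_contra! h
  have hpd := hp.mem_diagonal hS.1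
  have hrd := hr.mem_diagonal hS.1
  have hcomm : p * r = r * p := hS.1.1 p hpd r hrd
  obtain ⟨u, hu⟩ : ∃ u, p u - r (p u) ≠ 0 := by
    by_contra! h'
    exact h.1 (ContinuousLinearMap.ext fun u => (sub_eq_zero.1 (h' u)).symm)
  obtain ⟨v, hv⟩ : ∃ v, r v - p (r v) ≠ 0 := by
    by_contra! h'
    exact h.2 (ContinuousLinearMap.ext fun v => (sub_eq_zero.1 (h' v)).symm)
  set ξ := p u - r (p u) with hξ
  set η := r v - p (r v) with hη
  have hpp : ∀ w, p (p w) = p w := fun w => DFunLike.congr_fun hp.1 w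
  have hrr : ∀ w, r (r w) = r w := fun w => DFunLike.congr_fun hr.1 w
  have hpr : ∀ w, p (r w) = r (p w) := fun w => DFunLike.congr_fun hcomm w
  have hpξ : p ξ = ξ := by simp [hξ, hpp, hpr]
  have hrξ : r ξ = 0 := by simp [hξ, hrr]
  have hpη : p η = 0 := by simp [hη, hpp]
  have hrη : r η = η := by simp [hη, hrr, ← hpr]
  have hsa : ∀ {q : H →L[ℂ] H}, InLat S q → ∀ x y, ⟪q x, y⟫_ℂ = ⟪x, q y⟫_ℂ := fun {q} hq x y => by
    rw [← adjoint_inner_right, hq.2.1]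
  have key : ∀ {q : H →L[ℂ] H} (_ : InLat S q) (x y : H), q x = x → q y = 0 →
      rankOne ℂ x y ∈ S := fun {q} hq x y hx hy => by
    have : q * rankOne ℂ x y * (1 - q) = rankOne ℂ x y := by
      ext w
      simp [rankOne_apply, hx, inner_sub_right, ← hsa hq, hy]
    rw [← this]
    exact hq.corner_mem hS _
  have hx : rankOne ℂ ξ η ∈ diagonal S := by
    refine ⟨key hp _ _ hpξ hpη, ?_⟩
    rw [adjoint_rankOne]
    exact key hr _ _ hrη hrξ
  have := DFunLike.congr_fun (hS.1.1 p hpd _ hx) η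
  simp [rankOne_apply, hpξ, hpη] at this
  exact this.elim hv hu

/-- On the range of a proper invariant projection, a derivation is implemented. -/
theorem IsDerivation.exists_implements_on (hS : IsMaxTriangular S)
    {δ : S →L[ℂ] (H →L[ℂ] H)} (hδ : IsDerivation S δ) {p : H →L[ℂ] H} (hp : InLat S p)
    (hp1 : p ≠ 1) :
    ∃ b : H →L[ℂ] H, ‖b‖ ≤ ‖δ‖ ∧
      ∀ (a : S) (ξ : H), p ξ = ξ → δ a ξ = b ((a : H →L[ℂ] H) ξ) - (a : H →L[ℂ] H) (b ξ) := by
  have hpp : ∀ w, p (p w) = p w := fun w => DFunLike.congr_fun hp.1 w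
  obtain ⟨η, hη1, hpη⟩ : ∃ η : H, ‖η‖ = 1 ∧ p η = 0 := by
    obtain ⟨u, hu⟩ : ∃ u, u - p u ≠ 0 := by
      by_contra! h'
      exact hp1 (ContinuousLinearMap.ext fun u => (sub_eq_zero.1 (h' u)).symm)
    refine ⟨((‖u - p u‖⁻¹ : ℝ) : ℂ) • (u - p u), ?_, by simp [hpp]⟩
    rw [norm_smul]
    simp only [Complex.norm_real, norm_inv, norm_norm]
    exact inv_mul_cancel₀ (norm_ne_zero_iff.2 hu)
  have hsa : ∀ x y, ⟪p x, y⟫_ℂ = ⟪x, p y⟫_ℂ := fun x y => by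
    rw [← adjoint_inner_right, hp.2.1]
  have hmul : ∀ ξ, p * rankOne ℂ ξ η * (1 - p) = rankOne ℂ (p ξ) η := fun ξ => by
    ext w
    simp [rankOne_apply, inner_sub_right, ← hsa, hpη]
  let e : H →ₗ[ℂ] S :=
    { toFun := fun ξ => ⟨rankOne ℂ (p ξ) η, by rw [← hmul]; exact hp.corner_mem hS _⟩
      map_add' := fun x y => by ext w; simp
      map_smul' := fun c x => by ext w; simp }
  have he : ∀ ξ w, (e ξ : H →L[ℂ] H) w = ⟪η, w⟫_ℂ • p ξ := fun ξ w => rfl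
  have hηη : ⟪η, η⟫_ℂ = 1 := by simp [inner_self_eq_norm_sq_to_K, hη1]
  have hpn : ∀ ξ, ‖p ξ‖ ≤ ‖ξ‖ := fun ξ => by
    have h1 : ‖p ξ‖ * ‖p ξ‖ ≤ ‖ξ‖ * ‖p ξ‖ := by
      have h2 : ⟪p ξ, p ξ⟫_ℂ = ⟪ξ, p ξ⟫_ℂ := by rw [hsa, hpp]
      have h3 := norm_inner_le_norm (𝕜 := ℂ) ξ (p ξ)
      rw [← h2, inner_self_eq_norm_sq_to_K, sq] at h3
      simpa using h3
    rcases (norm_nonneg (p ξ)).eq_or_lt with h | h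
    · rw [← h]; exact norm_nonneg _
    · exact le_of_mul_le_mul_right h1 h
  have hen : ∀ ξ, ‖e ξ‖ ≤ ‖ξ‖ := fun ξ => by
    refine opNorm_le_bound _ (norm_nonneg _) fun w => ?_
    change ‖⟪η, w⟫_ℂ • p ξ‖ ≤ _
    rw [norm_smul, mul_comm]
    have := norm_inner_le_norm (𝕜 := ℂ) η w
    rw [hη1, one_mul] at this
    exact mul_le_mul (hpn ξ) this (norm_nonneg _) (norm_nonneg _)
  let b₀ : H →ₗ[ℂ] H :=
    { toFun := fun ξ => δ (e ξ) η
      map_add' := fun x y => by simp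
      map_smul' := fun c x => by simp }
  refine ⟨b₀.mkContinuous ‖δ‖ fun ξ => ?_, LinearMap.mkContinuous_norm_le _ (opNorm_nonneg δ) _, ?_⟩
  · calc ‖δ (e ξ) η‖ ≤ ‖δ (e ξ)‖ * ‖η‖ := le_opNorm _ _
      _ = ‖δ (e ξ)‖ := by rw [hη1, mul_one]
      _ ≤ ‖δ‖ * ‖e ξ‖ := le_opNorm _ _
      _ ≤ ‖δ‖ * ‖ξ‖ := by gcongr; exact hen ξ
  · intro a ξ hξ
    have hae : a * e ξ = e ((a : H →L[ℂ] H) ξ) := by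
      have h1 : (a : H →L[ℂ] H) (p ξ) = p ((a : H →L[ℂ] H) (p ξ)) :=
        DFunLike.congr_fun (hp.2.2 a a.2) ξ
      rw [hξ] at h1
      ext w
      simp [he, hξ, ← h1]
    have h2 : δ (a * e ξ) η = δ a ((e ξ : H →L[ℂ] H) η) + (a : H →L[ℂ] H) (δ (e ξ) η) :=
      DFunLike.congr_fun (hδ a (e ξ)) η
    rw [hae, he, hηη, one_smul, hξ] at h2
    change δ a ξ = δ (e _) η - (a : H →L[ℂ] H) (δ (e ξ) η)
    rw [h2, add_sub_cancel_right]

/-- A bounded family of operators converges in the weak operator topology along any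
ultrafilter, with the same norm bound on the limit. -/
theorem exists_weak_limit_of_norm_le {ι : Type*} (U : Ultrafilter ι) (B : ι → H →L[ℂ] H) {C : ℝ}
    (hC : 0 ≤ C) (hB : ∀ i, ‖B i‖ ≤ C) :
    ∃ b : H →L[ℂ] H, ‖b‖ ≤ C ∧
      ∀ ζ ξ, Tendsto (fun i => ⟪ζ, B i ξ⟫_ℂ) U (𝓝 ⟪ζ, b ξ⟫_ℂ) := by
  have hbd : ∀ i ζ ξ, ‖⟪ζ, B i ξ⟫_ℂ‖ ≤ C * ‖ζ‖ * ‖ξ‖ := fun i ζ ξ =>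
    calc ‖⟪ζ, B i ξ⟫_ℂ‖ ≤ ‖ζ‖ * ‖B i ξ‖ := norm_inner_le_norm _ _
      _ ≤ ‖ζ‖ * (C * ‖ξ‖) := by gcongr; exact le_of_opNorm_le _ (hB i) ξ
      _ = C * ‖ζ‖ * ‖ξ‖ := by ring
  have hlim : ∀ ζ ξ, ∃ l : ℂ, ‖l‖ ≤ C * ‖ζ‖ * ‖ξ‖ ∧
      Tendsto (fun i => ⟪ζ, B i ξ⟫_ℂ) U (𝓝 l) := fun ζ ξ => by
    obtain ⟨l, hl, hl'⟩ := (isCompact_closedBall (0 : ℂ) (C * ‖ζ‖ * ‖ξ‖)).ultrafilter_le_nhds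
      (U.map fun i => ⟪ζ, B i ξ⟫_ℂ) (by
        rw [le_principal_iff]
        exact Eventually.of_forall (f := (U : Filter ι)) fun i => by simpa using hbd i ζ ξ)
    exact ⟨l, by simpa using hl, hl'⟩
  choose l hl hlt using hlim
  let f : H →ₗ⋆[ℂ] H →ₗ[ℂ] ℂ := LinearMap.mk₂'ₛₗ _ _ l
    (fun x y z => tendsto_nhds_unique (hlt _ _)
      (by simpa only [inner_add_left] using (hlt x z).add (hlt y z)))
    (fun c x z => tendsto_nhds_unique (hlt _ _)
      (by simpa only [inner_smul_left, smul_eq_mul] using (hlt x z).const_mul _))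
    (fun x y z => tendsto_nhds_unique (hlt _ _)
      (by simpa only [map_add, inner_add_right] using (hlt x y).add (hlt x z)))
    (fun c x z => tendsto_nhds_unique (hlt _ _)
      (by simpa only [map_smul, inner_smul_right, smul_eq_mul, RingHom.id_apply]
        using (hlt x z).const_mul c))
  let F : H →L⋆[ℂ] H →L[ℂ] ℂ := LinearMap.mkContinuous₂ f C hl
  have hF : ∀ ζ ξ, F ζ ξ = l ζ ξ := fun ζ ξ => rfl
  refine ⟨adjoint (continuousLinearMapOfBilin F), ?_, fun ζ ξ => ?_⟩
  · rw [LinearIsometryEquiv.norm_map]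
    refine opNorm_le_bound _ hC fun ζ => ?_
    set z := continuousLinearMapOfBilin F ζ with hz
    have h1 : ⟪z, z⟫_ℂ = l ζ z := by rw [hz, continuousLinearMapOfBilin_apply, hF]
    have h2 := hl ζ z
    rw [← h1, inner_self_eq_norm_sq_to_K, sq] at h2
    have h3 : ‖z‖ * ‖z‖ ≤ C * ‖ζ‖ * ‖z‖ := by simpa using h2
    rcases (norm_nonneg z).eq_or_lt with h | h
    · rw [← h]; positivity
    · exact le_of_mul_le_mul_right h3 h
  · rw [adjoint_inner_right, continuousLinearMapOfBilin_apply, hF]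
    exact hlt ζ ξ

end

/-- (Theorem 10.) If `S` is maximal triangular, possesses a nontrivial invariant
projection, and `lat(S)` is strongly continuous at `1` (the union of the ranges of the
projections in `lat(S) \ {1}` has dense linear span), then every bounded derivation
`δ : S → B(H)` is implemented by some `b` with `‖b‖ ≤ 2‖δ‖`. -/
theorem deriv_implemented_of_continuous_at_one {H : Type*} [NormedAddCommGroup H]
    [InnerProductSpace ℂ H] [CompleteSpace H] {S : Subalgebra ℂ (H →L[ℂ] H)}
    (hS : IsMaxTriangular S)
    (hred : ∃ p : H →L[ℂ] H, InLat S p ∧ p ≠ 0 ∧ p ≠ 1)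
    (hdense : Dense (↑(Submodule.span ℂ
      (⋃ p ∈ {q : H →L[ℂ] H | InLat S q ∧ q ≠ 1}, Set.range ⇑p)) : Set H))
    (δ : S →L[ℂ] (H →L[ℂ] H)) (hδ : IsDerivation S δ) :
    ∃ b : H →L[ℂ] H, ‖b‖ ≤ 2 * ‖δ‖ ∧
      ∀ a : S, δ a = b * (a : H →L[ℂ] H) - (a : H →L[ℂ] H) * b := by
  let P := {q : H →L[ℂ] H // InLat S q ∧ q ≠ 1}
  obtain ⟨p₀, hp₀, -, hp₀1⟩ := hred
  have : Nonempty P := ⟨⟨p₀, hp₀, hp₀1⟩⟩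
  let G : Filter P := ⨅ p : P, 𝓟 {r : P | r.1 * p.1 = p.1}
  have hmono : ∀ {p r : P}, r.1 * p.1 = p.1 →
      {s : P | s.1 * r.1 = r.1} ⊆ {s : P | s.1 * p.1 = p.1} := fun {p r} h s hs => by
    change s.1 * p.1 = p.1
    rw [← h, ← mul_assoc, hs]
  have : G.NeBot := by
    refine iInf_neBot_of_directed' (fun p r => ?_)
      fun p => principal_neBot_iff.2 ⟨p, p.2.1.1⟩
    rcases p.2.1.total hS r.2.1 with h | h
    · exact ⟨r, principal_mono.2 (hmono h), le_rfl⟩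
    · exact ⟨p, le_rfl, principal_mono.2 (hmono h)⟩
  choose B hBn hB using fun p : P => hδ.exists_implements_on hS p.2.1 p.2.2
  obtain ⟨b, hbn, hb⟩ := exists_weak_limit_of_norm_le (Ultrafilter.of G) B (norm_nonneg δ) hBn
  refine ⟨b, by linarith [norm_nonneg δ], fun a => ?_⟩
  refine ContinuousLinearMap.ext_on hdense fun ξ hξ => ?_
  simp only [Set.mem_iUnion] at hξ
  obtain ⟨p, hp, w, rfl⟩ := hξ
  refine ext_inner_left ℂ fun ζ => ?_
  have hev : ∀ᶠ r : P in (Ultrafilter.of G : Filter P), r.1 (p w) = p w := by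
    refine Ultrafilter.of_le G (mem_iInf_of_mem (⟨p, hp⟩ : P) (mem_principal.2 fun r hr => ?_))
    exact DFunLike.congr_fun hr w
  have h1 := (hb ζ ((a : H →L[ℂ] H) (p w))).sub (hb (adjoint (a : H →L[ℂ] H) ζ) (p w))
  have h2 : Tendsto (fun _ : P => ⟪ζ, δ a (p w)⟫_ℂ) (Ultrafilter.of G : Filter P)
      (𝓝 ⟪ζ, δ a (p w)⟫_ℂ) := tendsto_const_nhds
  refine (tendsto_nhds_unique_of_eventuallyEq h2 h1 ?_).trans ?_
  · filter_upwards [hev] with r hr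
    rw [hB r a _ hr, inner_sub_right, adjoint_inner_left]
  · rw [adjoint_inner_left, ← inner_sub_right]
    rfl
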